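/- For all integers a, b ≥ 0 with a + b ≥ 1, the number of unimodular triangulations of the lattice trapezoid conv{(0,0), (1,0), (0,a), (1,b)} (width 1, vertical parallel sides of lengths a and b) equals the binomial coefficient C(a+b, a). -/

import Mathlib

open Set

noncomputable section

/-- A point of the integer lattice `ℤ² ⊆ ℝ²`. -/
def IsLatticePoint (p : ℝ × ℝ) : Prop := ∃ a b : ℤ, p = ((a : ℝ), (b : ℝ))

/-- A triangle: the convex hull of three affinely independent points of `ℝ²`. -/
def IsTriangle (Δ : Set (ℝ × ℝ)) : Prop :=
  ∃ p q r : ℝ × ℝ, AffineIndependent ℝ ![p, q, r] ∧ Δ = convexHull ℝ {p, q, r}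

/-- `F` is a face of the triangle `Δ`: the empty set, a vertex, an edge,
or the whole triangle. -/
def IsFaceOf (F Δ : Set (ℝ × ℝ)) : Prop :=
  ∃ p q r : ℝ × ℝ, AffineIndependent ℝ ![p, q, r] ∧ Δ = convexHull ℝ {p, q, r} ∧
    (F = ∅ ∨ F = {p} ∨ F = {q} ∨ F = {r} ∨
     F = segment ℝ p q ∨ F = segment ℝ q r ∨ F = segment ℝ p r ∨ F = Δ)

/-- The determinant of the two edge vectors of the triangle `pqr` emanating
from `p`; its absolute value is twice the Euclidean area of the triangle. -/
def triDet (p q r : ℝ × ℝ) : ℝ :=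
  (q.1 - p.1) * (r.2 - p.2) - (q.2 - p.2) * (r.1 - p.1)

/-- A unimodular triangle: a lattice triangle of area `1/2`. -/
def IsUnimodularTriangle (Δ : Set (ℝ × ℝ)) : Prop :=
  ∃ p q r : ℝ × ℝ, IsLatticePoint p ∧ IsLatticePoint q ∧ IsLatticePoint r ∧
    AffineIndependent ℝ ![p, q, r] ∧ Δ = convexHull ℝ {p, q, r} ∧
    |triDet p q r| = 1

/-- `T` is a unimodular triangulation of the region `P`. -/
def IsUnimodularTriangulation (P : Set (ℝ × ℝ)) (T : Set (Set (ℝ × ℝ))) : Prop :=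
  T.Finite ∧ (∀ Δ ∈ T, IsUnimodularTriangle Δ ∧ Δ ⊆ P) ∧ ⋃₀ T = P ∧
  ∀ Δ₁ ∈ T, ∀ Δ₂ ∈ T, IsFaceOf (Δ₁ ∩ Δ₂) Δ₁ ∧ IsFaceOf (Δ₁ ∩ Δ₂) Δ₂

/-- The number of unimodular triangulations of the region `P`. -/
def numTriangulations (P : Set (ℝ × ℝ)) : ℕ :=
  Set.ncard {T | IsUnimodularTriangulation P T}

/-- `f m n` is the number of unimodular triangulations of `[0,m] × [0,n]`. -/
def f (m n : ℕ) : ℕ :=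
  numTriangulations (Set.Icc (0, 0) ((m : ℝ), (n : ℝ)))

/-- `Δ₂` lies above `Δ₁` (written `Δ₁ ≺ Δ₂`). -/
def LiesAbove (Δ₁ Δ₂ : Set (ℝ × ℝ)) : Prop :=
  ∃ x y₁ y₂ : ℝ, (x, y₁) ∈ Δ₁ \ Δ₂ ∧ (x, y₂) ∈ Δ₂ \ Δ₁ ∧ y₁ < y₂

/-- The height above `x` of the line through `(0, s.1)` and `(1, s.2)`. -/
def height (s : ℕ × ℕ) (x : ℝ) : ℝ := (1 - x) * s.1 + x * s.2

/-- The part of the strip `0 ≤ x ≤ 1` between the lines of heights `s` and `t`. -/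
def slab (s t : ℕ × ℕ) : Set (ℝ × ℝ) :=
  {p | 0 ≤ p.1 ∧ p.1 ≤ 1 ∧ height s p.1 ≤ p.2 ∧ p.2 ≤ height t p.1}

/-- `Stack n T`: the set `T` consists of the triangles between consecutive lines of a lattice path
from `0` to `n`. -/
inductive Stack : ℕ × ℕ → Set (Set (ℝ × ℝ)) → Prop
  | nil : Stack 0 ∅
  | cons {t n : ℕ × ℕ} {T : Set (Set (ℝ × ℝ))} (h : t ⋖ n) (hT : Stack t T) :
      Stack n (insert (slab t n) T)

theorem nat_prod_covBy_iff {s t : ℕ × ℕ} :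
    s ⋖ t ↔ t = (s.1 + 1, s.2) ∨ t = (s.1, s.2 + 1) := by
  obtain ⟨a, b⟩ := s
  obtain ⟨c, d⟩ := t
  simp only [Prod.mk_covBy_mk_iff, Order.covBy_iff_add_one_eq, Prod.mk.injEq]
  omega

theorem height_mono {s t : ℕ × ℕ} (h : s ≤ t) {x : ℝ} (h0 : 0 ≤ x) (h1 : x ≤ 1) :
    height s x ≤ height t x := by
  have h1' : (s.1 : ℝ) ≤ t.1 := by exact_mod_cast h.1
  have h2' : (s.2 : ℝ) ≤ t.2 := by exact_mod_cast h.2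
  unfold height
  have : 0 ≤ 1 - x := by linarith
  gcongr

theorem height_lt_of_covBy {s t : ℕ × ℕ} (h : s ⋖ t) {x : ℝ} (h0 : 0 < x) (h1 : x < 1) :
    height s x < height t x := by
  unfold height
  rcases nat_prod_covBy_iff.1 h with rfl | rfl <;> push_cast <;> nlinarith

theorem slab_subset_slab {s t n : ℕ × ℕ} (h : t ≤ n) : slab s t ⊆ slab s n :=
  fun _ ⟨h0, h1, h2, h3⟩ => ⟨h0, h1, h2, h3.trans (height_mono h h0 h1)⟩

theorem slab_subset_slab_zero {s t n : ℕ × ℕ} (h : t ≤ n) : slab s t ⊆ slab 0 n :=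
  fun _ ⟨h0, h1, h2, h3⟩ =>
    ⟨h0, h1, (height_mono zero_le h0 h1).trans h2, h3.trans (height_mono h h0 h1)⟩

theorem convex_slab (s t : ℕ × ℕ) : Convex ℝ (slab s t) := by
  rintro ⟨x, y⟩ ⟨h0, h1, h2, h3⟩ ⟨x', y'⟩ ⟨h0', h1', h2', h3'⟩ a b ha hb hab
  simp only [height] at *
  have hb' : b = 1 - a := by linarith
  subst hb'
  refine ⟨?_, ?_, ?_, ?_⟩ <;>
    simp only [height, Prod.fst_add, Prod.snd_add, Prod.smul_fst, Prod.smul_snd, smul_eq_mul] <;>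
    nlinarith

theorem isClosed_slab (s t : ℕ × ℕ) : IsClosed (slab s t) := by
  simp only [slab, height, ofPred_and]
  refine (isClosed_le ?_ ?_).inter ((isClosed_le ?_ ?_).inter
    ((isClosed_le ?_ ?_).inter (isClosed_le ?_ ?_))) <;> fun_prop

theorem slab_eq_convexHull {s t : ℕ × ℕ} (h : s ≤ t) :
    slab s t = convexHull ℝ {((0 : ℝ), (s.1 : ℝ)), (1, (s.2 : ℝ)), (0, (t.1 : ℝ)),
      (1, (t.2 : ℝ))} := by
  have h1' : (s.1 : ℝ) ≤ t.1 := by exact_mod_cast h.1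
  have h2' : (s.2 : ℝ) ≤ t.2 := by exact_mod_cast h.2
  apply Subset.antisymm
  · rintro ⟨x, y⟩ ⟨h0, h1, h2, h3⟩
    simp only at h0 h1 h2 h3
    obtain ⟨c, hc0, hc1, hc⟩ : ∃ c : ℝ, 0 ≤ c ∧ c ≤ 1 ∧
        y = (1 - c) * height s x + c * height t x := by
      have hy : y ∈ Icc (height s x) (height t x) := ⟨h2, h3⟩
      rw [← segment_eq_Icc (h2.trans h3)] at hy
      obtain ⟨a, c, ha, hc, hac, rfl⟩ := hy
      refine ⟨c, hc, by linarith, ?_⟩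
      simp [← hac]
    have hC := convex_convexHull ℝ {((0 : ℝ), (s.1 : ℝ)), (1, (s.2 : ℝ)), (0, (t.1 : ℝ)),
      (1, (t.2 : ℝ))}
    have key : ∀ u : ℕ × ℕ, ((0 : ℝ), (u.1 : ℝ)) ∈ convexHull ℝ {((0 : ℝ), (s.1 : ℝ)),
        (1, (s.2 : ℝ)), (0, (t.1 : ℝ)), (1, (t.2 : ℝ))} →
        ((1 : ℝ), (u.2 : ℝ)) ∈ convexHull ℝ {((0 : ℝ), (s.1 : ℝ)),
        (1, (s.2 : ℝ)), (0, (t.1 : ℝ)), (1, (t.2 : ℝ))} →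
        (x, height u x) ∈ convexHull ℝ {((0 : ℝ), (s.1 : ℝ)),
        (1, (s.2 : ℝ)), (0, (t.1 : ℝ)), (1, (t.2 : ℝ))} := by
      intro u hu hu'
      convert hC hu hu' (by linarith : 0 ≤ 1 - x) h0 (by ring) using 1
      simp [height]
    have hs := key s (subset_convexHull ℝ _ (by simp)) (subset_convexHull ℝ _ (by simp))
    have ht := key t (subset_convexHull ℝ _ (by simp)) (subset_convexHull ℝ _ (by simp))
    convert hC hs ht (by linarith : 0 ≤ 1 - c) hc0 (by ring) using 1
    ext
    · simp; ring
    · simp [hc]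
  · refine convexHull_min ?_ (convex_slab s t)
    rintro p (rfl | rfl | rfl | rfl) <;> simp [slab, height, h1', h2']

theorem slab_injective {s t u v : ℕ × ℕ} (hst : s ≤ t) (huv : u ≤ v)
    (h : slab s t = slab u v) : s = u ∧ t = v := by
  have key : ∀ {s t u v : ℕ × ℕ}, s ≤ t → slab s t = slab u v → u ≤ s ∧ t ≤ v := by
    intro s t u v hst h
    have h1 : ((0 : ℝ), (s.1 : ℝ)) ∈ slab u v := h ▸ by simp [slab, height, hst.1]
    have h2 : ((1 : ℝ), (s.2 : ℝ)) ∈ slab u v := h ▸ by simp [slab, height, hst.2]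
    have h3 : ((0 : ℝ), (t.1 : ℝ)) ∈ slab u v := h ▸ by simp [slab, height, hst.1]
    have h4 : ((1 : ℝ), (t.2 : ℝ)) ∈ slab u v := h ▸ by simp [slab, height, hst.2]
    simp [slab, height] at h1 h2 h3 h4
    exact ⟨⟨h1.1, h2.1⟩, ⟨h3.2, h4.2⟩⟩
  have a := key hst h
  have b := key huv h.symm
  exact ⟨le_antisymm b.1 a.1, le_antisymm a.2 b.2⟩

theorem affineIndependent_of_triDet_ne_zero {p q r : ℝ × ℝ} (h : triDet p q r ≠ 0) :
    AffineIndependent ℝ ![p, q, r] := by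
  rw [affineIndependent_iff_of_fintype]
  intro w hw hp
  rw [Finset.weightedVSub_eq_linear_combination _ hw, Fin.sum_univ_three] at hp
  rw [Fin.sum_univ_three] at hw
  have hx := congrArg Prod.fst hp
  have hy := congrArg Prod.snd hp
  simp only [Matrix.cons_val_zero, Matrix.cons_val_one, Matrix.cons_val, Prod.fst_add,
    Prod.snd_add, Prod.smul_fst, Prod.smul_snd, smul_eq_mul, Prod.fst_zero, Prod.snd_zero]
    at hx hy
  have h1 : w 1 = 0 := by
    refine (mul_eq_zero.1 ?_).resolve_right h
    unfold triDet
    linear_combination (r.2 - p.2) * hx - (r.1 - p.1) * hy -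
      ((r.2 - p.2) * p.1 - (r.1 - p.1) * p.2) * hw
  have h2 : w 2 = 0 := by
    refine (mul_eq_zero.1 ?_).resolve_right h
    unfold triDet
    linear_combination (q.1 - p.1) * hy - (q.2 - p.2) * hx -
      ((q.1 - p.1) * p.2 - (q.2 - p.2) * p.1) * hw
  have h0 : w 0 = 0 := by linarith
  intro i
  fin_cases i <;> assumption

theorem exists_upper_triangle {s t : ℕ × ℕ} (h : s ⋖ t) :
    ∃ r : ℝ × ℝ, IsLatticePoint r ∧ |triDet (0, (t.1 : ℝ)) (1, (t.2 : ℝ)) r| = 1 ∧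
      slab s t = convexHull ℝ {((0 : ℝ), (t.1 : ℝ)), (1, (t.2 : ℝ)), r} := by
  rw [slab_eq_convexHull h.le]
  rcases nat_prod_covBy_iff.1 h with rfl | rfl
  · refine ⟨(0, s.1), ⟨0, s.1, by simp⟩, by simp [triDet], congrArg _ ?_⟩
    ext; simp; tauto
  · refine ⟨(1, s.2), ⟨1, s.2, by simp⟩, by simp [triDet], congrArg _ ?_⟩
    ext; simp; tauto

theorem exists_lower_triangle {s t : ℕ × ℕ} (h : s ⋖ t) :
    ∃ r : ℝ × ℝ, IsLatticePoint r ∧ |triDet (0, (s.1 : ℝ)) (1, (s.2 : ℝ)) r| = 1 ∧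
      slab s t = convexHull ℝ {((0 : ℝ), (s.1 : ℝ)), (1, (s.2 : ℝ)), r} := by
  rw [slab_eq_convexHull h.le]
  rcases nat_prod_covBy_iff.1 h with rfl | rfl
  · refine ⟨(0, s.1 + 1), ⟨0, s.1 + 1, by simp⟩, by simp [triDet], congrArg _ ?_⟩
    ext; simp; tauto
  · refine ⟨(1, s.2 + 1), ⟨1, s.2 + 1, by simp⟩, by simp [triDet], congrArg _ ?_⟩
    ext; simp; tauto

theorem affineIndependent_of_abs_triDet {p q r : ℝ × ℝ} (h : |triDet p q r| = 1) :
    AffineIndependent ℝ ![p, q, r] :=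
  affineIndependent_of_triDet_ne_zero fun h0 => by simp [h0] at h

theorem isUnimodularTriangle_slab {s t : ℕ × ℕ} (h : s ⋖ t) :
    IsUnimodularTriangle (slab s t) := by
  obtain ⟨r, hr, hd, he⟩ := exists_upper_triangle h
  exact ⟨_, _, r, ⟨0, t.1, by simp⟩, ⟨1, t.2, by simp⟩, hr,
    affineIndependent_of_abs_triDet hd, he, hd⟩

theorem IsUnimodularTriangle.isFaceOf_self {Δ : Set (ℝ × ℝ)} (h : IsUnimodularTriangle Δ) :
    IsFaceOf Δ Δ := by
  obtain ⟨p, q, r, -, -, -, hi, he, -⟩ := h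
  exact ⟨p, q, r, hi, he, by simp⟩

theorem slab_inter_slab {s t u v : ℕ × ℕ} (hst : s ≤ t) (huv : u ≤ v) (h : t ≤ u) :
    slab s t ∩ slab u v = ∅ ∨ slab s t ∩ slab u v = {((0 : ℝ), (t.1 : ℝ))} ∧ t.1 = u.1 ∨
      slab s t ∩ slab u v = {((1 : ℝ), (t.2 : ℝ))} ∧ t.2 = u.2 ∨
      slab s t ∩ slab u v = segment ℝ ((0 : ℝ), (t.1 : ℝ)) (1, (t.2 : ℝ)) ∧ t = u := by
  have hmem : ∀ x y : ℝ, (x, y) ∈ slab s t ∩ slab u v ↔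
      0 ≤ x ∧ x ≤ 1 ∧ y = height t x ∧ height t x = height u x := by
    intro x y
    constructor
    · rintro ⟨⟨h0, h1, h2, h3⟩, -, -, h4, h5⟩
      have := height_mono h h0 h1
      exact ⟨h0, h1, by simp only at *; linarith, by simp only at *; linarith⟩
    · rintro ⟨h0, h1, rfl, h2⟩
      exact ⟨⟨h0, h1, height_mono hst h0 h1, le_rfl⟩, h0, h1, h2.ge,
        h2.le.trans (height_mono huv h0 h1)⟩
  have h1' : (t.1 : ℝ) ≤ u.1 := by exact_mod_cast h.1
  have h2' : (t.2 : ℝ) ≤ u.2 := by exact_mod_cast h.2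
  rcases h.1.eq_or_lt with e1 | e1 <;> rcases h.2.eq_or_lt with e2 | e2
  · have e : t = u := Prod.ext e1 e2
    refine Or.inr (Or.inr (Or.inr ⟨?_, e⟩))
    ext ⟨x, y⟩
    rw [hmem, segment_eq_image]
    simp only [e, and_true, mem_image, mem_Icc, Prod.smul_mk, Prod.mk_add_mk, smul_eq_mul,
      mul_zero, mul_one, zero_add, Prod.mk.injEq, height]
    constructor
    · rintro ⟨h0, h1, rfl⟩
      exact ⟨x, ⟨h0, h1⟩, rfl, rfl⟩
    · rintro ⟨_, ⟨h0, h1⟩, rfl, rfl⟩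
      exact ⟨h0, h1, rfl⟩
  · refine Or.inr (Or.inl ⟨?_, e1⟩)
    have e2' : (t.2 : ℝ) < u.2 := by exact_mod_cast e2
    have e1' : (t.1 : ℝ) = u.1 := by exact_mod_cast e1
    ext ⟨x, y⟩
    rw [hmem, mem_singleton_iff, Prod.mk.injEq]
    constructor
    · rintro ⟨h0, h1, rfl, h2⟩
      simp only [height] at h2 ⊢
      have : x = 0 := by nlinarith
      simp [this]
    · rintro ⟨rfl, rfl⟩
      simp [height, e1]
  · refine Or.inr (Or.inr (Or.inl ⟨?_, e2⟩))
    have e2' : (t.2 : ℝ) = u.2 := by exact_mod_cast e2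
    have e1' : (t.1 : ℝ) < u.1 := by exact_mod_cast e1
    ext ⟨x, y⟩
    rw [hmem, mem_singleton_iff, Prod.mk.injEq]
    constructor
    · rintro ⟨h0, h1, rfl, h2⟩
      simp only [height] at h2 ⊢
      have : x = 1 := by nlinarith
      simp [this]
    · rintro ⟨rfl, rfl⟩
      simp [height, e2]
  · left
    have e2' : (t.2 : ℝ) < u.2 := by exact_mod_cast e2
    have e1' : (t.1 : ℝ) < u.1 := by exact_mod_cast e1
    ext ⟨x, y⟩
    rw [hmem]
    simp only [height, mem_empty_iff_false, iff_false]
    rintro ⟨h0, h1, -, h2⟩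
    rcases h0.eq_or_lt with rfl | h0
    · linarith
    · nlinarith

theorem isFaceOf_slab_inter_slab {s t u v : ℕ × ℕ} (hst : s ⋖ t) (huv : u ⋖ v) (h : t ≤ u) :
    IsFaceOf (slab s t ∩ slab u v) (slab s t) ∧ IsFaceOf (slab s t ∩ slab u v) (slab u v) := by
  obtain ⟨r, -, hd, he⟩ := exists_upper_triangle hst
  obtain ⟨r', -, hd', he'⟩ := exists_lower_triangle huv
  have H := slab_inter_slab hst.le huv.le h
  refine ⟨⟨_, _, r, affineIndependent_of_abs_triDet hd, he, by tauto⟩,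
    ⟨_, _, r', affineIndependent_of_abs_triDet hd', he', ?_⟩⟩
  rcases H with H | ⟨H, e⟩ | ⟨H, e⟩ | ⟨H, e⟩
  · exact Or.inl H
  · exact Or.inr (Or.inl (by rw [H, e]))
  · exact Or.inr (Or.inr (Or.inl (by rw [H, e])))
  · exact Or.inr (Or.inr (Or.inr (Or.inr (Or.inl (by rw [H, e])))))

theorem IsLatticePoint.eq_of_mem_slab {p : ℝ × ℝ} (hp : IsLatticePoint p) {n : ℕ × ℕ}
    (h : p ∈ slab 0 n) :
    ∃ k : ℕ, (p = ((0 : ℝ), (k : ℝ)) ∧ k ≤ n.1) ∨ (p = ((1 : ℝ), (k : ℝ)) ∧ k ≤ n.2) := by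
  obtain ⟨a, b, rfl⟩ := hp
  obtain ⟨h0, h1, h2, h3⟩ := h
  simp only [height, Prod.fst_zero, Prod.snd_zero, Nat.cast_zero, mul_zero, add_zero] at h0 h1 h2 h3
  lift b to ℕ using by exact_mod_cast h2
  have ha0 : 0 ≤ a := by exact_mod_cast h0
  have ha1 : a ≤ 1 := by exact_mod_cast h1
  refine ⟨b, ?_⟩
  obtain rfl | rfl : a = 0 ∨ a = 1 := by omega
  · left
    simpa using h3
  · right
    simpa using h3

theorem nat_eq_add_one_of_abs_sub {k l : ℕ} (h : |(k : ℝ) - l| = 1) : k = l + 1 ∨ l = k + 1 := by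
  rcases eq_or_eq_neg_of_abs_eq h with h | h
  · left
    have : (k : ℝ) = l + 1 := by linarith
    exact_mod_cast this
  · right
    have : (l : ℝ) = k + 1 := by linarith
    exact_mod_cast this

theorem exists_slab_of_left_side {k l j : ℕ} {n : ℕ × ℕ} (hk : k ≤ n.1) (hl : l ≤ n.1)
    (hj : j ≤ n.2) (h : |(k : ℝ) - l| = 1) : ∃ s t : ℕ × ℕ, s ⋖ t ∧ t ≤ n ∧
      convexHull ℝ {((0 : ℝ), (k : ℝ)), (0, (l : ℝ)), (1, (j : ℝ))} = slab s t := by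
  rcases nat_eq_add_one_of_abs_sub h with rfl | rfl
  · have hc : (l, j) ⋖ (l + 1, j) := nat_prod_covBy_iff.2 (Or.inl rfl)
    refine ⟨_, _, hc, ⟨hk, hj⟩, ?_⟩
    rw [slab_eq_convexHull hc.le]
    congr 1; ext; simp; tauto
  · have hc : (k, j) ⋖ (k + 1, j) := nat_prod_covBy_iff.2 (Or.inl rfl)
    refine ⟨_, _, hc, ⟨hl, hj⟩, ?_⟩
    rw [slab_eq_convexHull hc.le]
    congr 1; ext; simp

theorem exists_slab_of_right_side {i k l : ℕ} {n : ℕ × ℕ} (hi : i ≤ n.1) (hk : k ≤ n.2)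
    (hl : l ≤ n.2) (h : |(k : ℝ) - l| = 1) : ∃ s t : ℕ × ℕ, s ⋖ t ∧ t ≤ n ∧
      convexHull ℝ {((0 : ℝ), (i : ℝ)), (1, (k : ℝ)), (1, (l : ℝ))} = slab s t := by
  rcases nat_eq_add_one_of_abs_sub h with rfl | rfl
  · have hc : (i, l) ⋖ (i, l + 1) := nat_prod_covBy_iff.2 (Or.inr rfl)
    refine ⟨_, _, hc, ⟨hi, hk⟩, ?_⟩
    rw [slab_eq_convexHull hc.le]
    congr 1; ext; simp; tauto
  · have hc : (i, k) ⋖ (i, k + 1) := nat_prod_covBy_iff.2 (Or.inr rfl)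
    refine ⟨_, _, hc, ⟨hi, hl⟩, ?_⟩
    rw [slab_eq_convexHull hc.le]
    congr 1; ext; simp; tauto

theorem IsUnimodularTriangle.eq_slab {Δ : Set (ℝ × ℝ)} (h : IsUnimodularTriangle Δ)
    {n : ℕ × ℕ} (hΔ : Δ ⊆ slab 0 n) : ∃ s t : ℕ × ℕ, s ⋖ t ∧ t ≤ n ∧ Δ = slab s t := by
  obtain ⟨p, q, r, lp, lq, lr, -, rfl, hd⟩ := h
  obtain ⟨i, hp⟩ := lp.eq_of_mem_slab (hΔ (subset_convexHull ℝ _ (by simp)))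
  obtain ⟨j, hq⟩ := lq.eq_of_mem_slab (hΔ (subset_convexHull ℝ _ (by simp)))
  obtain ⟨k, hr⟩ := lr.eq_of_mem_slab (hΔ (subset_convexHull ℝ _ (by simp)))
  clear hΔ lp lq lr
  rcases hp with ⟨rfl, hp⟩ | ⟨rfl, hp⟩ <;> rcases hq with ⟨rfl, hq⟩ | ⟨rfl, hq⟩ <;>
    rcases hr with ⟨rfl, hr⟩ | ⟨rfl, hr⟩ <;> simp [triDet] at hd
  · exact exists_slab_of_left_side hp hq hr (by rw [← hd, abs_sub_comm])
  · rw [pair_comm]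
    exact exists_slab_of_left_side hp hr hq (by rw [← hd, abs_sub_comm])
  · exact exists_slab_of_right_side hp hq hr (by rw [← hd, abs_sub_comm])
  · rw [insert_comm, pair_comm]
    exact exists_slab_of_left_side hq hr hp (by rw [← hd, abs_sub_comm])
  · rw [insert_comm]
    exact exists_slab_of_right_side hq hp hr (by rw [← hd, abs_sub_comm])
  · rw [pair_comm, insert_comm]
    exact exists_slab_of_right_side hr hp hq (by rw [← hd, abs_sub_comm])

theorem mem_interior_slab {s t : ℕ × ℕ} {x y : ℝ} (h0 : 0 < x) (h1 : x < 1)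
    (h2 : height s x < y) (h3 : y < height t x) : (x, y) ∈ interior (slab s t) := by
  have hsub : {p : ℝ × ℝ | 0 < p.1 ∧ p.1 < 1 ∧ height s p.1 < p.2 ∧ p.2 < height t p.1} ⊆
      slab s t := fun p ⟨a, b, c, d⟩ => ⟨a.le, b.le, c.le, d.le⟩
  refine interior_maximal hsub ?_ ⟨h0, h1, h2, h3⟩
  simp only [height, ofPred_and]
  refine (isOpen_lt ?_ ?_).inter ((isOpen_lt ?_ ?_).inter
    ((isOpen_lt ?_ ?_).inter (isOpen_lt ?_ ?_))) <;> fun_prop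

theorem disjoint_segment_interior_triangle (b : AffineBasis (Fin 3) ℝ (ℝ × ℝ)) {i j k : Fin 3}
    (hi : i ≠ k) (hj : j ≠ k) {z : ℝ × ℝ} (hz : z ∈ segment ℝ (b i) (b j)) :
    z ∉ interior (convexHull ℝ (range b)) := by
  rw [b.interior_convexHull]
  intro h
  have hk : 0 < b.coord k z := h k
  rw [segment_eq_image_lineMap] at hz
  obtain ⟨c, -, rfl⟩ := hz
  rw [AffineMap.apply_lineMap, b.coord_apply_ne hi.symm, b.coord_apply_ne hj.symm] at hk
  simp at hk

theorem IsFaceOf.eq_of_mem_interior {F Δ : Set (ℝ × ℝ)} (h : IsFaceOf F Δ) {z : ℝ × ℝ}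
    (hzF : z ∈ F) (hz : z ∈ interior Δ) : F = Δ := by
  obtain ⟨p, q, r, hi, he, hF⟩ := h
  have hspan : affineSpan ℝ (range ![p, q, r]) = ⊤ := by
    rw [hi.affineSpan_eq_top_iff_card_eq_finrank_add_one]
    simp
  let b : AffineBasis (Fin 3) ℝ (ℝ × ℝ) := ⟨![p, q, r], hi, hspan⟩
  have hr : range b = {p, q, r} := by
    change range ![p, q, r] = _
    rw [Matrix.range_cons, Matrix.range_cons_cons_empty, singleton_union]
  rw [he, ← hr] at hz
  have h01 : z ∉ segment ℝ p q := fun h =>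
    disjoint_segment_interior_triangle b (i := 0) (j := 1) (k := 2) (by decide) (by decide) h hz
  have h12 : z ∉ segment ℝ q r := fun h =>
    disjoint_segment_interior_triangle b (i := 1) (j := 2) (k := 0) (by decide) (by decide) h hz
  have h02 : z ∉ segment ℝ p r := fun h =>
    disjoint_segment_interior_triangle b (i := 0) (j := 2) (k := 1) (by decide) (by decide) h hz
  rcases hF with rfl | rfl | rfl | rfl | rfl | rfl | rfl | rfl
  · exact hzF.elim
  · exact (h01 (mem_singleton_iff.1 hzF ▸ left_mem_segment ℝ p q)).elim
  · exact (h01 (mem_singleton_iff.1 hzF ▸ right_mem_segment ℝ p q)).elim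
  · exact (h12 (mem_singleton_iff.1 hzF ▸ right_mem_segment ℝ q r)).elim
  · exact (h01 hzF).elim
  · exact (h12 hzF).elim
  · exact (h02 hzF).elim
  · rfl

theorem exists_height_lt {t v : ℕ × ℕ} (h : ¬ v ≤ t) :
    ∃ x : ℝ, 0 < x ∧ x < 1 ∧ height t x < height v x := by
  have : t.1 < v.1 ∨ t.2 < v.2 := by
    by_contra! h'
    exact h h'
  have p1 : (0 : ℝ) ≤ t.1 := by positivity
  have p2 : (0 : ℝ) ≤ t.2 := by positivity
  have p3 : (0 : ℝ) ≤ v.1 := by positivity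
  have p4 : (0 : ℝ) ≤ v.2 := by positivity
  rcases this with h | h
  · have h' : (t.1 : ℝ) + 1 ≤ v.1 := by exact_mod_cast h
    refine ⟨1 / (t.2 + 2), by positivity, ?_, ?_⟩
    · rw [div_lt_one (by positivity)]; linarith
    · unfold height
      field_simp
      nlinarith
  · have h' : (t.2 : ℝ) + 1 ≤ v.2 := by exact_mod_cast h
    refine ⟨1 - 1 / (t.1 + 2), ?_, ?_, ?_⟩
    · rw [sub_pos, div_lt_one (by positivity)]; linarith
    · rw [sub_lt_self_iff]; positivity
    · unfold height
      field_simp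
      nlinarith

theorem le_of_isFaceOf_inter {t n u v : ℕ × ℕ} (huv : u ⋖ v) (hvn : v ≤ n)
    (h₁ : IsFaceOf (slab t n ∩ slab u v) (slab t n))
    (h₂ : IsFaceOf (slab t n ∩ slab u v) (slab u v)) (hne : slab u v ≠ slab t n) : v ≤ t := by
  by_contra hvt
  obtain ⟨x, h0, h1, hx⟩ := exists_height_lt hvt
  obtain ⟨y, hy, hy'⟩ := exists_between (max_lt hx (height_lt_of_covBy huv h0 h1))
  obtain ⟨hy1, hy2⟩ := max_lt_iff.1 hy
  have m1 := mem_interior_slab h0 h1 hy1 (hy'.trans_le (height_mono hvn h0.le h1.le))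
  have m2 := mem_interior_slab h0 h1 hy2 hy'
  have m : (x, y) ∈ slab t n ∩ slab u v := ⟨interior_subset m1, interior_subset m2⟩
  exact hne ((h₂.eq_of_mem_interior m m2).symm.trans (h₁.eq_of_mem_interior m m1))

theorem IsUnimodularTriangulation.exists_top {n : ℕ × ℕ} {T : Set (Set (ℝ × ℝ))}
    (hT : IsUnimodularTriangulation (slab 0 n) T) : ∃ t, t ⋖ n ∧ slab t n ∈ T := by
  obtain ⟨-, hT1, hT2, -⟩ := hT
  have hz : ((1 / 2 : ℝ), height n (1 / 2)) ∈ slab 0 n :=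
    ⟨by norm_num, by norm_num, height_mono zero_le (by norm_num) (by norm_num), le_rfl⟩
  rw [← hT2] at hz
  obtain ⟨Δ, hΔ, hz⟩ := hz
  obtain ⟨s, t, hst, htn, rfl⟩ := (hT1 Δ hΔ).1.eq_slab (hT1 Δ hΔ).2
  obtain ⟨-, -, -, hz⟩ := hz
  have h1 : (t.1 : ℝ) ≤ n.1 := by exact_mod_cast htn.1
  have h2 : (t.2 : ℝ) ≤ n.2 := by exact_mod_cast htn.2
  simp only [height] at hz
  have e1 : (t.1 : ℝ) = n.1 := by linarith
  have e2 : (t.2 : ℝ) = n.2 := by linarith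
  obtain rfl : t = n := Prod.ext (by exact_mod_cast e1) (by exact_mod_cast e2)
  exact ⟨s, hst, hΔ⟩

theorem IsUnimodularTriangulation.eq_slab_of_ne {t n : ℕ × ℕ} {T : Set (Set (ℝ × ℝ))}
    (hT : IsUnimodularTriangulation (slab 0 n) T) (ht : slab t n ∈ T) {Δ : Set (ℝ × ℝ)}
    (hΔ : Δ ∈ T) (hne : Δ ≠ slab t n) : ∃ u v : ℕ × ℕ, u ⋖ v ∧ v ≤ t ∧ Δ = slab u v := by
  obtain ⟨-, hT1, -, hT3⟩ := hT
  obtain ⟨u, v, huv, hvn, rfl⟩ := (hT1 Δ hΔ).1.eq_slab (hT1 Δ hΔ).2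
  obtain ⟨h1, h2⟩ := hT3 _ ht _ hΔ
  exact ⟨u, v, huv, le_of_isFaceOf_inter huv hvn h1 h2 hne, rfl⟩

theorem slab_zero_subset_closure {t : ℕ × ℕ} (ht0 : t ≠ 0) :
    slab 0 t ⊆ closure {p ∈ slab 0 t | p.2 < height t p.1} := by
  have hpos : 0 < height t (1 / 2) := by
    have h1 : (0 : ℝ) ≤ t.1 := by positivity
    have h2 : (0 : ℝ) ≤ t.2 := by positivity
    have h3 : (t.1 : ℝ) + t.2 ≠ 0 := by
      intro h
      apply ht0
      have : t.1 + t.2 = 0 := by exact_mod_cast h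
      exact Prod.ext (by simp; omega) (by simp; omega)
    unfold height
    have : (0 : ℝ) < t.1 + t.2 := lt_of_le_of_ne (by positivity) h3.symm
    linarith
  have hw : ((1 / 2 : ℝ), (0 : ℝ)) ∈ slab 0 t :=
    ⟨by norm_num, by norm_num, by simp [height], hpos.le⟩
  intro z hz
  refine closure_mono ?_ (segment_subset_closure_openSegment (left_mem_segment ℝ z (1 / 2, 0)))
  intro p hp
  refine ⟨(convex_slab 0 t).openSegment_subset hz hw hp, ?_⟩
  obtain ⟨a, b, ha, hb, hab, rfl⟩ := hp
  obtain ⟨-, -, -, hz⟩ := hz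
  have h1 := mul_le_mul_of_nonneg_left hz ha.le
  have h2 := mul_pos hb hpos
  obtain rfl : b = 1 - a := by linarith
  simp only [height, Prod.fst_add, Prod.snd_add, Prod.smul_fst, Prod.smul_snd, smul_eq_mul]
    at h1 h2 ⊢
  linarith

theorem IsUnimodularTriangulation.diff_singleton {t n : ℕ × ℕ} {T : Set (Set (ℝ × ℝ))}
    (hT : IsUnimodularTriangulation (slab 0 n) T) (htn : t ⋖ n) (ht : slab t n ∈ T)
    (ht0 : t ≠ 0) : IsUnimodularTriangulation (slab 0 t) (T \ {slab t n}) := by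
  have hsub : ∀ Δ ∈ T \ {slab t n}, Δ ⊆ slab 0 t := by
    rintro Δ ⟨hΔ, hne⟩
    obtain ⟨u, v, -, hv, rfl⟩ := hT.eq_slab_of_ne ht hΔ hne
    exact slab_subset_slab_zero hv
  obtain ⟨hT0, hT1, hT2, hT3⟩ := hT
  refine ⟨hT0.subset sdiff_subset, fun Δ hΔ => ⟨(hT1 Δ hΔ.1).1, hsub Δ hΔ⟩,
    Subset.antisymm (sUnion_subset hsub) ?_, fun Δ₁ h₁ Δ₂ h₂ => hT3 Δ₁ h₁.1 Δ₂ h₂.1⟩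
  have hclosed : IsClosed (⋃₀ (T \ {slab t n})) := by
    rw [sUnion_eq_biUnion]
    refine (hT0.subset sdiff_subset).isClosed_biUnion fun Δ hΔ => ?_
    obtain ⟨s, u, -, -, rfl⟩ := (hT1 Δ hΔ.1).1.eq_slab (hT1 Δ hΔ.1).2
    exact isClosed_slab s u
  refine (slab_zero_subset_closure ht0).trans (closure_minimal ?_ hclosed)
  rintro p ⟨hp, hlt⟩
  have hp' : p ∈ ⋃₀ T := hT2 ▸ slab_subset_slab htn.le hp
  obtain ⟨Δ, hΔ, hpΔ⟩ := hp'
  refine ⟨Δ, ⟨hΔ, ?_⟩, hpΔ⟩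
  rintro rfl
  exact absurd hlt (not_lt_of_ge hpΔ.2.2.1)

theorem IsUnimodularTriangulation.stack {n : ℕ × ℕ} {T : Set (Set (ℝ × ℝ))}
    (hT : IsUnimodularTriangulation (slab 0 n) T) : Stack n T := by
  induction n using WellFoundedLT.induction generalizing T with
  | ind n ih =>
    obtain ⟨t, htn, ht⟩ := hT.exists_top
    rw [← insert_sdiff_self_of_mem ht]
    refine .cons htn ?_
    by_cases ht0 : t = 0
    · subst ht0
      suffices T \ {slab 0 n} = ∅ by rw [this]; exact .nil
      rw [eq_empty_iff_forall_notMem]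
      rintro Δ ⟨hΔ, hne⟩
      obtain ⟨u, v, huv, hv, -⟩ := hT.eq_slab_of_ne ht hΔ hne
      exact absurd huv.lt (not_lt_of_ge (hv.trans zero_le))
    · exact ih t htn.lt (hT.diff_singleton htn ht ht0)

theorem Stack.exists_slab {n : ℕ × ℕ} {T : Set (Set (ℝ × ℝ))} (h : Stack n T) :
    ∀ Δ ∈ T, ∃ s t : ℕ × ℕ, s ⋖ t ∧ t ≤ n ∧ Δ = slab s t := by
  induction h with
  | nil => simp
  | @cons t n T h hT ih =>
    rintro Δ (rfl | hΔ)
    · exact ⟨t, n, h, le_rfl, rfl⟩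
    · obtain ⟨s, u, hs, hu, rfl⟩ := ih Δ hΔ
      exact ⟨s, u, hs, hu.trans h.le, rfl⟩

theorem Stack.eq_empty {T : Set (Set (ℝ × ℝ))} (h : Stack 0 T) : T = ∅ := by
  rw [eq_empty_iff_forall_notMem]
  intro Δ hΔ
  obtain ⟨s, t, hs, ht, -⟩ := h.exists_slab Δ hΔ
  exact absurd hs.lt (not_lt_of_ge (ht.trans zero_le))

theorem Stack.isUnimodularTriangulation {n : ℕ × ℕ} {T : Set (Set (ℝ × ℝ))} (h : Stack n T)
    (hn : n ≠ 0) : IsUnimodularTriangulation (slab 0 n) T := by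
  induction h with
  | nil => exact (hn rfl).elim
  | @cons t n T htn hT ih =>
    have hn' : IsUnimodularTriangle (slab t n) ∧ slab t n ⊆ slab 0 n :=
      ⟨isUnimodularTriangle_slab htn, slab_subset_slab_zero le_rfl⟩
    by_cases ht0 : t = 0
    · subst ht0
      rw [hT.eq_empty]
      simp [IsUnimodularTriangulation, hn', hn'.1.isFaceOf_self]
    obtain ⟨hT0, hT1, hT2, hT3⟩ := ih ht0
    have hface : ∀ Δ ∈ T, IsFaceOf (Δ ∩ slab t n) Δ ∧ IsFaceOf (Δ ∩ slab t n) (slab t n) := by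
      intro Δ hΔ
      obtain ⟨s, u, hsu, hut, rfl⟩ := hT.exists_slab Δ hΔ
      exact isFaceOf_slab_inter_slab hsu htn hut
    refine ⟨hT0.insert _, ?_, ?_, ?_⟩
    · rintro Δ (rfl | hΔ)
      · exact hn'
      · exact ⟨(hT1 Δ hΔ).1, (hT1 Δ hΔ).2.trans (slab_subset_slab htn.le)⟩
    · rw [sUnion_insert, hT2]
      refine Subset.antisymm (union_subset hn'.2 (slab_subset_slab htn.le)) ?_
      rintro p ⟨h0, h1, h2, h3⟩
      rcases le_total (height t p.1) p.2 with h | h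
      · exact Or.inl ⟨h0, h1, h, h3⟩
      · exact Or.inr ⟨h0, h1, h2, h⟩
    · rintro Δ₁ (rfl | h₁) Δ₂ (rfl | h₂)
      · rw [inter_self]
        exact ⟨hn'.1.isFaceOf_self, hn'.1.isFaceOf_self⟩
      · rw [inter_comm]
        exact (hface Δ₂ h₂).symm
      · exact hface Δ₁ h₁
      · exact hT3 Δ₁ h₁ Δ₂ h₂

theorem Stack.slab_notMem {m n t : ℕ × ℕ} {T : Set (Set (ℝ × ℝ))} (h : Stack t T)
    (htn : t ⋖ n) (hmn : m ≤ n) : slab m n ∉ T := by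
  intro hm
  obtain ⟨s, u, hs, hu, he⟩ := h.exists_slab _ hm
  obtain ⟨-, rfl⟩ := slab_injective hmn hs.le he
  exact absurd htn.lt (not_lt_of_ge hu)

theorem encard_image_insert_stack {t n : ℕ × ℕ} (h : t ⋖ n) :
    (insert (slab t n) '' {T | Stack t T}).encard = {T | Stack t T}.encard := by
  apply InjOn.encard_image
  intro T hT T' hT' he
  rw [← insert_sdiff_self_of_notMem (Stack.slab_notMem hT h h.le), he,
    insert_sdiff_self_of_notMem (Stack.slab_notMem hT' h h.le)]

theorem stack_iff {n : ℕ × ℕ} (hn : n ≠ 0) {T : Set (Set (ℝ × ℝ))} :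
    Stack n T ↔ ∃ t, t ⋖ n ∧ ∃ T', Stack t T' ∧ insert (slab t n) T' = T := by
  constructor
  · rintro (_ | ⟨h, hT⟩)
    · exact (hn rfl).elim
    · exact ⟨_, h, _, hT, rfl⟩
  · rintro ⟨t, h, T', hT', rfl⟩
    exact .cons h hT'

theorem encard_stack (a b : ℕ) : {T | Stack (a, b) T}.encard = (a + b).choose a := by
  match a, b with
  | 0, 0 =>
    have : {T | Stack (0, 0) T} = {∅} := by
      ext T
      exact ⟨fun h => Stack.eq_empty h, by rintro rfl; exact Stack.nil⟩
    simp [this]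
  | a + 1, 0 =>
    have h : (a, 0) ⋖ (a + 1, 0) := nat_prod_covBy_iff.2 (Or.inl rfl)
    have : {T | Stack (a + 1, 0) T} = insert (slab (a, 0) (a + 1, 0)) '' {T | Stack (a, 0) T} := by
      ext T
      simp [stack_iff, nat_prod_covBy_iff]
    rw [this, encard_image_insert_stack h, encard_stack a 0]
    simp
  | 0, b + 1 =>
    have h : (0, b) ⋖ (0, b + 1) := nat_prod_covBy_iff.2 (Or.inr rfl)
    have : {T | Stack (0, b + 1) T} = insert (slab (0, b) (0, b + 1)) '' {T | Stack (0, b) T} := by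
      ext T
      simp [stack_iff, nat_prod_covBy_iff]
    rw [this, encard_image_insert_stack h, encard_stack 0 b]
    simp
  | a + 1, b + 1 =>
    have h : (a, b + 1) ⋖ (a + 1, b + 1) := nat_prod_covBy_iff.2 (Or.inl rfl)
    have h' : (a + 1, b) ⋖ (a + 1, b + 1) := nat_prod_covBy_iff.2 (Or.inr rfl)
    have : {T | Stack (a + 1, b + 1) T} =
        insert (slab (a, b + 1) (a + 1, b + 1)) '' {T | Stack (a, b + 1) T} ∪
        insert (slab (a + 1, b) (a + 1, b + 1)) '' {T | Stack (a + 1, b) T} := by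
      ext T
      rw [mem_ofPred_eq, stack_iff (by simp)]
      constructor
      · rintro ⟨⟨c, d⟩, hc, T', hT', rfl⟩
        rcases nat_prod_covBy_iff.1 hc with e | e <;> simp only [Prod.mk.injEq,
          Nat.add_right_cancel_iff] at e <;> obtain ⟨rfl, rfl⟩ := e
        · exact Or.inl ⟨T', hT', rfl⟩
        · exact Or.inr ⟨T', hT', rfl⟩
      · rintro (⟨T', hT', rfl⟩ | ⟨T', hT', rfl⟩)
        · exact ⟨_, h, T', hT', rfl⟩
        · exact ⟨_, h', T', hT', rfl⟩
    rw [this, encard_union_eq, encard_image_insert_stack h, encard_image_insert_stack h',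
      encard_stack a (b + 1), encard_stack (a + 1) b]
    · norm_cast
      rw [show a + 1 + (b + 1) = a + (b + 1) + 1 by ring, Nat.choose_succ_succ]
      congr 2
      ring
    · rw [Set.disjoint_left]
      rintro _ ⟨T, hT, rfl⟩ ⟨T', hT', he⟩
      have hm : slab (a, b + 1) (a + 1, b + 1) ∈ insert (slab (a + 1, b) (a + 1, b + 1)) T' :=
        he ▸ mem_insert _ _
      rcases hm with hm | hm
      · simpa using (slab_injective h.le h'.le hm).1
      · exact Stack.slab_notMem hT' h' h.le hm

/-- The number of unimodular triangulations of the width-1 lattice trapezoid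
`conv{(0,0), (1,0), (0,a), (1,b)}` equals `C(a+b, a)`. -/
theorem trapezoid_count (a b : ℕ) (hab : 1 ≤ a + b) :
    numTriangulations
        (convexHull ℝ {((0 : ℝ), (0 : ℝ)), (1, 0), (0, (a : ℝ)), (1, (b : ℝ))}) =
      Nat.choose (a + b) a := by
  have hn : ((a, b) : ℕ × ℕ) ≠ 0 := by
    rw [Ne, Prod.mk_eq_zero]
    omega
  have hP : convexHull ℝ {((0 : ℝ), (0 : ℝ)), (1, 0), (0, (a : ℝ)), (1, (b : ℝ))} =
      slab 0 (a, b) := by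
    rw [slab_eq_convexHull zero_le]
    simp
  have hS : {T | IsUnimodularTriangulation (slab 0 (a, b)) T} = {T | Stack (a, b) T} :=
    Set.ext fun T => ⟨fun h => h.stack, fun h => h.isUnimodularTriangulation hn⟩
  rw [numTriangulations, hP, hS, ncard, encard_stack, ENat.toNat_natCast]
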